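/- Let q = 2^r with r ≥ 2 an integer. Set N₃ = |SO⁺(4,q)| = q²(q²−1)², and for 0 ≤ j ≤ N₃ let C_{3,j} denote the number of codewords of Hamming weight j in the binary code C(SO⁺(4,q)). Then for every integer h ≥ 1, the identity MK₂^h = Σ_{l=0}^{h−1} (−1)^{h+l+1} binom(h,l) (q⁴ − q³ − 2q² + 1)^{h−l} MK₂^l + q^{1−2h} · Σ_{j=0}^{min(N₃,h)} (−1)^{h+j} C_{3,j} Σ_{t=j}^{h} t! S(h,t) 2^{h−t} binom(N₃−j, N₃−t) holds (an identity in ℚ). -/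

import Mathlib

open Finset Matrix

/-- The quadratic form `θ⁺(x) = ∑ i, x_i x_{n+i}` on `F^{2n}` (columns indexed by `Fin n ⊕ Fin n`). -/
def thetaPlus (F : Type) [Field F] (n : ℕ) (x : Fin n ⊕ Fin n → F) : F :=
  ∑ i : Fin n, x (Sum.inl i) * x (Sum.inr i)

/-- The orthogonal group `O⁺(2n,q)`: invertible matrices preserving `θ⁺`. -/
noncomputable def OplusGrp (F : Type) [Field F] [Fintype F] [DecidableEq F] (n : ℕ) :
    Finset (Matrix (Fin n ⊕ Fin n) (Fin n ⊕ Fin n) F) := by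
  classical
  exact Finset.univ.filter (fun w => IsUnit w ∧
    ∀ x : Fin n ⊕ Fin n → F, thetaPlus F n (w.mulVec x) = thetaPlus F n x)

/-- `SO⁺(2n,q)`: the kernel of `δ⁺(w) = Tr(B ᵗC)` on `O⁺(2n,q)`,
where `w = [[A,B],[C,D]]` in `n × n` blocks. -/
noncomputable def SOplusGrp (F : Type) [Field F] [Fintype F] [DecidableEq F] (n : ℕ) :
    Finset (Matrix (Fin n ⊕ Fin n) (Fin n ⊕ Fin n) F) := by
  classical
  exact (OplusGrp F n).filter
    (fun w => Matrix.trace (Matrix.toBlocks₁₂ w * (Matrix.toBlocks₂₁ w)ᵀ) = 0)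

/-- The trace map `tr(x) = x + x² + ⋯ + x^{2^{r−1}}`, valued in `𝔽₂ = {0,1} ⊆ F`. -/
def trF (F : Type) [Field F] (r : ℕ) (x : F) : F := ∑ i ∈ Finset.range r, x ^ 2 ^ i

/-- The canonical additive character `λ(x) = (−1)^{tr(x)} ∈ {±1} ⊆ ℤ`. -/
noncomputable def lam (F : Type) [Field F] (r : ℕ) (x : F) : ℤ := by
  classical exact if trF F r x = 0 then 1 else -1

/-- The trace map `tr` viewed as a function into `𝔽₂ = ZMod 2`. -/
noncomputable def tr2 (F : Type) [Field F] (r : ℕ) (x : F) : ZMod 2 := by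
  classical exact if trF F r x = 0 then 0 else 1

/-- The Kloosterman sum `K(λ;a) = ∑_{α ∈ F*} λ(α + aα⁻¹)`. -/
noncomputable def Kl (F : Type) [Field F] [Fintype F] (r : ℕ) (a : F) : ℤ := by
  classical
  exact ∑ α ∈ Finset.univ.filter (fun α : F => α ≠ 0), lam F r (α + a * α⁻¹)

/-- The `m`-dimensional Kloosterman sum
`K_m(λ;a) = ∑_{α₁,…,α_m ∈ F*} λ(α₁ + ⋯ + α_m + aα₁⁻¹⋯α_m⁻¹)`;
for `m = 0` this is `K₀(λ;a) = λ(a)`. -/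
noncomputable def Klm (F : Type) [Field F] [Fintype F] (r m : ℕ) (a : F) : ℤ := by
  classical
  exact ∑ v ∈ Finset.univ.filter (fun v : Fin m → F => ∀ i, v i ≠ 0),
    lam F r ((∑ i, v i) + a * (∏ i, v i)⁻¹)

/-- The power moment `MK^h = ∑_{a ∈ F*} K(λ;a)^h`. -/
noncomputable def MK (F : Type) [Field F] [Fintype F] (r h : ℕ) : ℤ := by
  classical exact ∑ a ∈ Finset.univ.filter (fun a : F => a ≠ 0), (Kl F r a) ^ h

/-- The power moment `MK₂^h = ∑_{a ∈ F*} K₂(λ;a)^h` of 2-dimensional Kloosterman sums. -/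
noncomputable def MK2 (F : Type) [Field F] [Fintype F] (r h : ℕ) : ℤ := by
  classical exact ∑ a ∈ Finset.univ.filter (fun a : F => a ≠ 0), (Klm F r 2 a) ^ h

/-- The binary code `C(G) = {u ∈ 𝔽₂^G : ∑_{g ∈ G} u_g Tr(g) = 0 in F}`. -/
noncomputable def code (F : Type) [Field F] [Fintype F] [DecidableEq F]
    {ι : Type} [Fintype ι] [DecidableEq ι] (G : Finset (Matrix ι ι F)) :
    Finset (↥G → ZMod 2) := by
  classical
  exact Finset.univ.filter
    (fun u => ∑ g : ↥G, (u g).val • Matrix.trace (g : Matrix ι ι F) = 0)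

/-- Number of codewords of Hamming weight `j` in the code `C(G)`. -/
noncomputable def wtCount (F : Type) [Field F] [Fintype F] [DecidableEq F]
    {ι : Type} [Fintype ι] [DecidableEq ι] (G : Finset (Matrix ι ι F)) (j : ℕ) : ℕ := by
  classical
  exact ((code F G).filter
    (fun u => (Finset.univ.filter (fun g : ↥G => u g = 1)).card = j)).card

/-- `t! · S(h,t)` where `S(h,t)` is the Stirling number of the second kind,
`S(h,t) = (1/t!) ∑_{j=0}^{t} (−1)^{t−j} C(t,j) j^h`. -/
def tS (h t : ℕ) : ℤ :=
  ∑ j ∈ Finset.range (t + 1), (-1 : ℤ) ^ (t - j) * (t.choose j : ℤ) * (j : ℤ) ^ h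

/-- Binomial coefficient with integer arguments: `0` whenever `k < 0` or `k > n`. -/
def ichoose (n k : ℤ) : ℤ := if 0 ≤ k ∧ k ≤ n then (n.toNat.choose k.toNat : ℤ) else 0

section TraceCharacter

variable {F : Type} [Field F] {r : ℕ}

theorem trF_add [CharP F 2] (x y : F) : trF F r (x + y) = trF F r x + trF F r y := by
  simp [trF, add_pow_char_pow, Finset.sum_add_distrib]

theorem trF_sq_eq_sq_trF [CharP F 2] (x : F) : trF F r (x ^ 2) = trF F r x ^ 2 := by
  simp only [trF, sum_pow_char, ← pow_mul, mul_comm]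

theorem trF_sq [Fintype F] [CharP F 2] (hF : Fintype.card F = 2 ^ r) (x : F) :
    trF F r (x ^ 2) = trF F r x := by
  have hx : x ^ 2 ^ r = x := by rw [← hF, FiniteField.pow_card]
  have h₁ := Finset.sum_range_succ (fun i => x ^ 2 ^ i) r
  have h₂ := Finset.sum_range_succ' (fun i => x ^ 2 ^ i) r
  simp only [pow_zero, pow_one, hx] at h₁ h₂
  have h₃ : trF F r (x ^ 2) = ∑ i ∈ Finset.range r, x ^ 2 ^ (i + 1) := by
    simp only [trF, pow_succ', pow_mul]
  rw [h₃, trF]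
  exact (add_right_cancel (h₁.symm.trans h₂)).symm

theorem trF_eq_zero_or_one [Fintype F] [CharP F 2] (hF : Fintype.card F = 2 ^ r) (x : F) :
    trF F r x = 0 ∨ trF F r x = 1 := by
  have h : trF F r x * (trF F r x - 1) = 0 := by
    rw [mul_sub, ← sq, ← trF_sq_eq_sq_trF, trF_sq hF, mul_one, sub_self]
  simpa [sub_eq_zero] using h

theorem exists_trF_ne_zero [Fintype F] (hr : 1 ≤ r) (hF : Fintype.card F = 2 ^ r) :
    ∃ x : F, trF F r x ≠ 0 := by
  classical
  by_contra! hc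
  obtain ⟨s, rfl⟩ := Nat.exists_eq_add_of_le' hr
  let p : Polynomial F := ∑ i ∈ Finset.range (s + 1), Polynomial.X ^ 2 ^ i
  have hdeg : p.natDegree < Fintype.card F := by
    rw [hF]
    refine (Polynomial.natDegree_sum_le_of_forall_le (n := 2 ^ s) _ _ fun i hi => ?_).trans_lt
      (Nat.pow_lt_pow_right one_lt_two (Nat.lt_succ_self s))
    rw [Polynomial.natDegree_X_pow]
    exact Nat.pow_le_pow_right two_pos (Nat.le_of_lt_succ (Finset.mem_range.1 hi))
  have hp : p = 0 := by
    refine Polynomial.eq_zero_of_natDegree_lt_card_of_eval_eq_zero p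
      (f := (id : F → F)) Function.injective_id (fun x => ?_) hdeg
    simpa [p, Polynomial.eval_finsetSum, trF] using hc x
  have hcoeff : p.coeff 1 = 1 := by
    simp only [p, Polynomial.finsetSum_coeff, Polynomial.coeff_X_pow]
    rw [Finset.sum_eq_single 0] <;> simp
    intro b _ hb h
    exact hb (by simpa using h.symm)
  simp [hp] at hcoeff

theorem lam_zero : lam F r 0 = 1 := by
  simp [lam, trF]

theorem lam_add [Fintype F] [CharP F 2] (hF : Fintype.card F = 2 ^ r) (x y : F) :
    lam F r (x + y) = lam F r x * lam F r y := by
  have h2 : (1 : F) + 1 = 0 := CharTwo.add_self_eq_zero 1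
  rcases trF_eq_zero_or_one hF x with hx | hx <;> rcases trF_eq_zero_or_one hF y with hy | hy <;>
    simp [lam, trF_add, hx, hy, h2]

theorem lam_sq [Fintype F] [CharP F 2] (hF : Fintype.card F = 2 ^ r) (x : F) :
    lam F r (x ^ 2) = lam F r x := by
  unfold lam
  congr 1
  rw [trF_sq hF]

theorem lam_eq_one_or_neg_one (x : F) : lam F r x = 1 ∨ lam F r x = -1 := by
  unfold lam
  split_ifs <;> simp

theorem lam_sum [Fintype F] [CharP F 2] (hF : Fintype.card F = 2 ^ r) {ι : Type*}
    (s : Finset ι) (f : ι → F) : lam F r (∑ i ∈ s, f i) = ∏ i ∈ s, lam F r (f i) := by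
  classical
  induction s using Finset.induction_on with
  | empty => simp [lam_zero]
  | insert a s ha ih => rw [Finset.sum_insert ha, Finset.prod_insert ha, lam_add hF, ih]

theorem sum_lam [Fintype F] [CharP F 2] (hr : 1 ≤ r) (hF : Fintype.card F = 2 ^ r) :
    ∑ x : F, lam F r x = 0 := by
  obtain ⟨y, hy⟩ := exists_trF_ne_zero hr hF
  have h : ∑ x : F, lam F r x = -∑ x : F, lam F r x := by
    conv_lhs => rw [← Equiv.sum_comp (Equiv.addRight y)]
    rw [← Finset.sum_neg_distrib]
    refine Finset.sum_congr rfl fun x _ => ?_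
    simp [lam_add hF, show lam F r y = -1 by simp [lam, hy]]
  linarith

theorem sum_lam_mul [Fintype F] [DecidableEq F] [CharP F 2] (hr : 1 ≤ r)
    (hF : Fintype.card F = 2 ^ r) (b : F) :
    ∑ x : F, lam F r (b * x) = if b = 0 then 2 ^ r else 0 := by
  split_ifs with hb
  · simp [hb, lam_zero, hF]
  · rw [← sum_lam (F := F) hr hF]
    exact Equiv.sum_comp (Equiv.mulLeft₀ b hb) (lam F r)

theorem bijective_sq [Fintype F] [CharP F 2] : Function.Bijective fun x : F => x ^ 2 :=
  Finite.injective_iff_bijective.1 fun x y h => by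
    simpa using CharTwo.sq_injective h

/-- Artin–Schreier: `y² + y = c` has `1 + λ(c)` solutions. -/
theorem card_sq_add_self_eq [Fintype F] [DecidableEq F] [CharP F 2] (hr : 1 ≤ r)
    (hF : Fintype.card F = 2 ^ r) (c : F) :
    ((univ.filter fun y : F => y ^ 2 + y = c).card : ℤ) = 1 + lam F r c := by
  have key : ∑ y : F, ∑ b : F, lam F r ((y ^ 2 + y + c) * b) = 2 ^ r * (1 + lam F r c) := by
    have : ∀ y d : F, lam F r ((y ^ 2 + y + c) * d ^ 2) =
        lam F r (c * d ^ 2) * lam F r ((d + d ^ 2) * y) := fun y d => by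
      rw [show (y ^ 2 + y + c) * d ^ 2 = c * d ^ 2 + ((d * y) ^ 2 + d ^ 2 * y) by ring,
        lam_add hF, lam_add hF, lam_sq hF, ← lam_add hF]
      ring_nf
    rw [Finset.sum_congr rfl fun y _ =>
      (bijective_sq.sum_comp (fun b => lam F r ((y ^ 2 + y + c) * b))).symm]
    simp only [this]
    rw [Finset.sum_comm]
    simp only [← Finset.mul_sum, sum_lam_mul hr hF]
    have h01 : ∀ d : F, d + d ^ 2 = 0 ↔ d = 0 ∨ d = 1 := fun d => by
      rw [show d + d ^ 2 = d * (1 + d) by ring, mul_eq_zero, CharTwo.add_eq_zero, eq_comm (a := 1)]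
    simp only [mul_ite, mul_zero, h01]
    rw [← Finset.sum_filter, Finset.filter_or, Finset.sum_union (by
      simp [Finset.filter_eq'])]
    simp [Finset.filter_eq', lam_zero]
    ring
  simp only [sum_lam_mul hr hF, CharTwo.add_eq_zero] at key
  rw [← Finset.sum_filter, Finset.sum_const, nsmul_eq_mul, mul_comm] at key
  exact mul_left_cancel₀ (by positivity) key

end TraceCharacter

section PowerMoment

theorem pow_eq_sum_choose_mul_tS (h n : ℕ) :
    (n : ℤ) ^ h = ∑ t ∈ Finset.range (h + 1), (n.choose t : ℤ) * tS h t := by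
  have htS : ∀ t, tS h t = (fwdDiff (1 : ℤ))^[t] (fun x : ℤ => x ^ h) 0 := fun t => by
    simp [fwdDiff_iter_eq_sum_shift, tS]
  have hnewton := shift_eq_sum_fwdDiff_iter (1 : ℤ) (fun x : ℤ => x ^ h) n 0
  simp only [zero_add, nsmul_eq_mul, mul_one, ← htS] at hnewton
  rw [hnewton]
  rcases le_total n h with hnh | hnh
  · refine Finset.sum_subset (Finset.range_mono (by omega)) fun t _ ht => ?_
    rw [Nat.choose_eq_zero_of_lt (by simpa using ht)]
    simp
  · refine (Finset.sum_subset (Finset.range_mono (by omega)) fun t _ ht => ?_).symm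
    rw [htS, fwdDiff_iter_pow_eq_zero_of_lt (by simpa using ht)]
    simp

variable {F : Type} [Field F] [Fintype F] [DecidableEq F] {r : ℕ}
  {ι : Type} [Fintype ι] [DecidableEq ι]

theorem two_pow_mul_choose_card_filter (x : ι → ℤ) (hx : ∀ i, x i = 1 ∨ x i = -1) (t : ℕ) :
    (2 : ℤ) ^ t * ((univ.filter fun i => x i = -1).card.choose t : ℤ) =
      ∑ T ∈ (univ : Finset ι).powersetCard t, ∑ U ∈ T.powerset, (-1) ^ U.card * ∏ i ∈ U, x i := by
  have hT : ∀ T ∈ (univ : Finset ι).powersetCard t,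
      ∑ U ∈ T.powerset, (-1) ^ U.card * ∏ i ∈ U, x i =
        if T ⊆ univ.filter (fun i => x i = -1) then (2 : ℤ) ^ t else 0 := by
    intro T hT
    have hprod : ∏ i ∈ T, (1 + -x i) = ∑ U ∈ T.powerset, (-1) ^ U.card * ∏ i ∈ U, x i := by
      rw [Finset.prod_one_add]
      exact Finset.sum_congr rfl fun U _ => Finset.prod_neg _
    rw [← hprod]
    split_ifs with h
    · rw [← (Finset.mem_powersetCard.1 hT).2, ← Finset.prod_const]
      refine Finset.prod_congr rfl fun i hi => ?_
      rw [(Finset.mem_filter.1 (h hi)).2]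
      norm_num
    · obtain ⟨i, hi, hne⟩ := Finset.not_subset.1 h
      have : x i = 1 := (hx i).resolve_right (by simpa using hne)
      exact Finset.prod_eq_zero hi (by rw [this]; norm_num)
  rw [Finset.sum_congr rfl hT, ← Finset.sum_filter, Finset.sum_const, nsmul_eq_mul, mul_comm,
    ← Finset.card_powersetCard]
  congr 3
  ext T
  simp [Finset.mem_powersetCard, and_comm]

theorem sum_powersetCard_sum_powerset (φ : Finset ι → ℤ) (t : ℕ) :
    ∑ T ∈ (univ : Finset ι).powersetCard t, ∑ U ∈ T.powerset, φ U =
      ∑ U : Finset ι, if U.card ≤ t then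
        ((Fintype.card ι - U.card).choose (t - U.card) : ℤ) * φ U else 0 := by
  have hcard : ∀ U : Finset ι, U.card ≤ t →
      (((univ : Finset ι).powersetCard t).filter (U ⊆ ·)).card =
        (Fintype.card ι - U.card).choose (t - U.card) := by
    intro U hU
    rw [← Finset.card_compl, ← Finset.card_powersetCard]
    refine Finset.card_nbij' (· \ U) (· ∪ U) ?_ ?_ ?_ ?_
    · intro T hT
      simp only [Finset.coe_filter, Finset.mem_powersetCard, Set.mem_ofPred_eq] at hT
      simp only [Finset.mem_coe, Finset.mem_powersetCard]
      refine ⟨fun i hi => by simpa using (Finset.mem_sdiff.1 hi).2, ?_⟩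
      rw [Finset.card_sdiff_of_subset hT.2, hT.1.2]
    · intro T hT
      simp only [Finset.mem_coe, Finset.mem_powersetCard] at hT
      have hd : Disjoint T U := Finset.subset_compl_iff_disjoint_right.1 hT.1
      simp [Finset.mem_powersetCard, Finset.card_union_of_disjoint hd, hT.2, hU]
    · intro T hT
      simp only [Finset.coe_filter, Set.mem_ofPred_eq] at hT
      exact Finset.sdiff_union_of_subset hT.2
    · intro T hT
      simp only [Finset.mem_coe, Finset.mem_powersetCard] at hT
      have hd : Disjoint T U := Finset.subset_compl_iff_disjoint_right.1 hT.1
      exact Finset.union_sdiff_cancel_right hd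
  calc _ = ∑ T ∈ (univ : Finset ι).powersetCard t, ∑ U : Finset ι, if U ⊆ T then φ U else 0 := by
        refine Finset.sum_congr rfl fun T _ => ?_
        rw [← Finset.sum_filter]
        exact Finset.sum_congr (by ext; simp) fun _ _ => rfl
    _ = _ := by
        rw [Finset.sum_comm]
        refine Finset.sum_congr rfl fun U _ => ?_
        rw [← Finset.sum_filter, Finset.sum_const, nsmul_eq_mul]
        split_ifs with hU
        · rw [hcard U hU]
        · rw [Finset.filter_false_of_mem]
          · simp
          · intro T hT hUT
            exact hU ((Finset.card_le_card hUT).trans (Finset.mem_powersetCard.1 hT).2.le)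

/-- Binomial-moment form of the MacWilliams identity for the words `(tr (a f i))_i`. -/
theorem sum_choose_card_filter_lam [CharP F 2] (hr : 1 ≤ r) (hF : Fintype.card F = 2 ^ r)
    (f : ι → F) (t : ℕ) :
    ∑ a : F, (2 : ℤ) ^ t * ((univ.filter fun i => lam F r (a * f i) = -1).card.choose t : ℤ) =
      2 ^ r * ∑ j ∈ Finset.range (t + 1), (-1) ^ j *
        ((univ.filter fun U : Finset ι => ∑ i ∈ U, f i = 0 ∧ U.card = j).card : ℤ) *
          ((Fintype.card ι - j).choose (t - j) : ℤ) := by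
  have hx : ∀ (a : F) (i : ι), lam F r (a * f i) = 1 ∨ lam F r (a * f i) = -1 :=
    fun a i => lam_eq_one_or_neg_one _
  simp only [fun a => two_pow_mul_choose_card_filter (fun i => lam F r (a * f i)) (hx a) t,
    ← lam_sum hF, ← Finset.mul_sum, sum_powersetCard_sum_powerset]
  rw [Finset.sum_comm]
  have hU : ∀ U : Finset ι, ∑ a : F, (if U.card ≤ t then
      ((Fintype.card ι - U.card).choose (t - U.card) : ℤ) *
        ((-1) ^ U.card * lam F r (a * ∑ i ∈ U, f i)) else 0) =
      2 ^ r * ∑ j ∈ Finset.range (t + 1), if ∑ i ∈ U, f i = 0 ∧ U.card = j then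
        (-1) ^ j * ((Fintype.card ι - j).choose (t - j) : ℤ) else 0 := by
    intro U
    simp only [mul_comm _ (∑ i ∈ U, f i), ite_and]
    by_cases hUt : U.card ≤ t
    · simp only [if_pos hUt, ← Finset.mul_sum, sum_lam_mul hr hF]
      by_cases h0 : ∑ i ∈ U, f i = 0
      · simp [h0, Nat.lt_succ_of_le hUt]
        ring
      · simp [h0]
    · have : ¬ U.card < t + 1 := by omega
      by_cases h0 : ∑ i ∈ U, f i = 0 <;> simp [hUt, h0, this]
  rw [Finset.sum_congr rfl fun U _ => hU U, ← Finset.mul_sum, Finset.sum_comm]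
  congr 1
  refine Finset.sum_congr rfl fun j _ => ?_
  rw [← Finset.sum_filter, Finset.sum_const, nsmul_eq_mul]
  ring

theorem wtCount_eq {κ : Type} [Fintype κ] [DecidableEq κ] (G : Finset (Matrix κ κ F)) (j : ℕ) :
    wtCount F G j = (univ.filter fun U : Finset ↥G =>
      ∑ g ∈ U, Matrix.trace (g : Matrix κ κ F) = 0 ∧ U.card = j).card := by
  have h01 : ∀ z : ZMod 2, z ≠ 1 → z = 0 := by decide
  have hsum : ∀ u : ↥G → ZMod 2, ∑ g : ↥G, (u g).val • Matrix.trace (g : Matrix κ κ F) =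
      ∑ g ∈ univ.filter (fun g => u g = 1), Matrix.trace (g : Matrix κ κ F) := by
    intro u
    rw [Finset.sum_filter]
    refine Finset.sum_congr rfl fun g _ => ?_
    split_ifs with h
    · simp [h, ZMod.val_one]
    · simp [h01 _ h]
  unfold wtCount code
  refine Finset.card_nbij' (fun u => univ.filter fun g => u g = 1)
    (fun U g => if g ∈ U then 1 else 0) ?_ ?_ ?_ ?_
  · intro u hu
    simp only [Finset.coe_filter, Finset.mem_filter, Finset.mem_univ, true_and,
      Set.mem_ofPred_eq, hsum] at hu ⊢
    exact hu
  · intro U hU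
    simp only [Finset.coe_filter, Finset.mem_filter, Finset.mem_univ, true_and,
      Set.mem_ofPred_eq, hsum] at hU ⊢
    rwa [show (univ.filter fun g => (if g ∈ U then (1 : ZMod 2) else 0) = 1) = U by ext; simp]
  · intro u _
    ext g
    by_cases h : u g = 1
    · simp [h]
    · simp [h01 _ h]
  · intro U _
    ext g
    simp

theorem wtCount_eq_zero_of_lt {κ : Type} [Fintype κ] [DecidableEq κ]
    (G : Finset (Matrix κ κ F)) {j : ℕ} (hj : G.card < j) : wtCount F G j = 0 := by
  rw [wtCount_eq, Finset.card_eq_zero, Finset.filter_eq_empty_iff]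
  rintro U - ⟨-, rfl⟩
  exact hj.not_ge ((Finset.card_le_univ U).trans_eq (Fintype.card_coe G))

/-- Pless power moment identity for the dual of `C(G)`. -/
theorem sum_card_filter_lam_pow [CharP F 2] (hr : 1 ≤ r) (hF : Fintype.card F = 2 ^ r)
    {κ : Type} [Fintype κ] [DecidableEq κ] (G : Finset (Matrix κ κ F)) (h : ℕ) :
    ∑ a : F, (2 : ℤ) ^ h * ((univ.filter fun g : ↥G =>
        lam F r (a * Matrix.trace (g : Matrix κ κ F)) = -1).card : ℤ) ^ h =
      2 ^ r * ∑ j ∈ Finset.range (min G.card h + 1), (-1) ^ j * (wtCount F G j : ℤ) *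
        ∑ t ∈ Finset.Icc j h, tS h t * 2 ^ (h - t) *
          ichoose ((G.card : ℤ) - (j : ℤ)) ((G.card : ℤ) - (t : ℤ)) := by
  have hich : ∀ j t : ℕ, j ≤ G.card → j ≤ t →
      ichoose ((G.card : ℤ) - (j : ℤ)) ((G.card : ℤ) - (t : ℤ)) =
        ((G.card - j).choose (t - j) : ℤ) := by
    intro j t hj hjt
    unfold ichoose
    split_ifs with hc
    · rw [Nat.choose_symm_of_eq_add (show G.card - j = (t - j) + (G.card - t) by omega)]
      congr 2 <;> omega
    · rw [Nat.choose_eq_zero_of_lt (by omega), Nat.cast_zero]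
  have hterm : ∀ t ∈ Finset.range (h + 1), ∑ a : F, (2 : ℤ) ^ h * (((univ.filter fun g : ↥G =>
        lam F r (a * Matrix.trace (g : Matrix κ κ F)) = -1).card.choose t : ℤ) * tS h t) =
      2 ^ r * ∑ j ∈ Finset.range (h + 1), if j ≤ t then (-1) ^ j * (wtCount F G j : ℤ) *
        (tS h t * 2 ^ (h - t) * ((G.card - j).choose (t - j) : ℤ)) else 0 := by
    intro t ht
    have ht' : t ≤ h := Nat.le_of_lt_succ (Finset.mem_range.1 ht)
    have key := sum_choose_card_filter_lam hr hF
      (fun g : ↥G => Matrix.trace (g : Matrix κ κ F)) t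
    simp only [← wtCount_eq, Fintype.card_coe] at key
    have hrange : (Finset.range (h + 1)).filter (· ≤ t) = Finset.range (t + 1) := by
      ext j
      simp
      omega
    rw [← Finset.sum_filter, hrange]
    calc _ = tS h t * 2 ^ (h - t) * ∑ a : F, (2 : ℤ) ^ t * ((univ.filter fun g : ↥G =>
          lam F r (a * Matrix.trace (g : Matrix κ κ F)) = -1).card.choose t : ℤ) := by
          rw [Finset.mul_sum]
          refine Finset.sum_congr rfl fun a _ => ?_
          rw [← pow_sub_mul_pow (2 : ℤ) ht']
          ring
      _ = _ := by
          rw [key, mul_left_comm, Finset.mul_sum]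
          congr 1
          exact Finset.sum_congr rfl fun j _ => by ring
  simp only [pow_eq_sum_choose_mul_tS h, Finset.mul_sum (Finset.range (h + 1))]
  rw [Finset.sum_comm, Finset.sum_congr rfl hterm, ← Finset.mul_sum, Finset.sum_comm]
  congr 1
  symm
  refine (Finset.sum_congr rfl fun j hj => ?_).trans
    (Finset.sum_subset (Finset.range_mono (by omega)) fun j hjh hj => ?_)
  · have hj' : j ≤ min G.card h := Nat.le_of_lt_succ (Finset.mem_range.1 hj)
    rw [← Finset.sum_filter, Finset.mul_sum]
    refine Finset.sum_congr ?_ fun t ht => ?_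
    · ext t
      simp
      omega
    · rw [hich j t (by omega) (Finset.mem_filter.1 ht).2]
  · rw [wtCount_eq_zero_of_lt G (by simp at hj hjh; omega)]
    simp

end PowerMoment

section OrthogonalGroup

/-- Coordinates of `F^{2+2}` as entries of a `2 × 2` matrix, so that `θ⁺` becomes the determinant
in characteristic two. -/
def blockIdx : Fin 2 ⊕ Fin 2 ≃ Fin 2 × Fin 2 where
  toFun := Sum.elim ![(0, 0), (0, 1)] ![(1, 1), (1, 0)]
  invFun p := ![![Sum.inl 0, Sum.inl 1], ![Sum.inr 1, Sum.inr 0]] p.1 p.2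
  left_inv := by decide
  right_inv := by decide

@[simp] theorem blockIdx_inl_zero : blockIdx (Sum.inl 0) = (0, 0) := rfl
@[simp] theorem blockIdx_inl_one : blockIdx (Sum.inl 1) = (0, 1) := rfl
@[simp] theorem blockIdx_inr_zero : blockIdx (Sum.inr 0) = (1, 1) := rfl
@[simp] theorem blockIdx_inr_one : blockIdx (Sum.inr 1) = (1, 0) := rfl

variable {F : Type} [Field F]

/-- The matrix of `X ↦ P X Qᵀ` on `2 × 2` matrices. -/
def tensorMat (P Q : Matrix (Fin 2) (Fin 2) F) : Matrix (Fin 2 ⊕ Fin 2) (Fin 2 ⊕ Fin 2) F :=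
  (kroneckerMap (· * ·) P Q).submatrix blockIdx blockIdx

theorem tensorMat_apply (P Q : Matrix (Fin 2) (Fin 2) F) (i j : Fin 2 ⊕ Fin 2) :
    tensorMat P Q i j =
      P (blockIdx i).1 (blockIdx j).1 * Q (blockIdx i).2 (blockIdx j).2 := rfl

theorem trace_tensorMat (P Q : Matrix (Fin 2) (Fin 2) F) :
    (tensorMat P Q).trace = P.trace * Q.trace := by
  rw [← trace_kronecker]
  exact Equiv.sum_comp blockIdx fun p => kroneckerMap (· * ·) P Q p p

theorem tensorMat_mul (P P' Q Q' : Matrix (Fin 2) (Fin 2) F) :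
    tensorMat P Q * tensorMat P' Q' = tensorMat (P * P') (Q * Q') := by
  rw [tensorMat, tensorMat, submatrix_mul_equiv, ← mul_kronecker_mul]
  rfl

theorem tensorMat_one : tensorMat (1 : Matrix (Fin 2) (Fin 2) F) 1 = 1 := by
  have h : kroneckerMap (· * ·) (1 : Matrix (Fin 2) (Fin 2) F) (1 : Matrix (Fin 2) (Fin 2) F) = 1 :=
    one_kronecker_one
  rw [tensorMat, h, submatrix_one_equiv]

theorem tensorMat_adjugate_mul {P Q : Matrix (Fin 2) (Fin 2) F} (hP : P.det = 1)
    (hQ : Q.det = 1) : tensorMat P.adjugate Q.adjugate * tensorMat P Q = 1 := by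
  rw [tensorMat_mul, adjugate_mul, adjugate_mul, hP, hQ, one_smul, tensorMat_one]

theorem det_adjugate_of_det_eq_one {P : Matrix (Fin 2) (Fin 2) F} (hP : P.det = 1) :
    P.adjugate.det = 1 := by
  simp [det_adjugate, hP]

theorem tensorMat_injOn [CharP F 2] {P P' Q Q' : Matrix (Fin 2) (Fin 2) F}
    (hP : P.det = 1) (hP' : P'.det = 1) (hQ : Q.det = 1) (hQ' : Q'.det = 1)
    (h : tensorMat P Q = tensorMat P' Q') : P = P' ∧ Q = Q' := by
  have hent : ∀ i j k l, P i j * Q k l = P' i j * Q' k l := fun i j k l => by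
    have := congrFun₂ h (blockIdx.symm (i, k)) (blockIdx.symm (j, l))
    simpa [tensorMat_apply] using this
  rw [det_fin_two] at hP hP' hQ hQ'
  constructor <;> ext i j <;> refine CharTwo.sq_injective ?_ <;> dsimp only
  · linear_combination P i j * Q 1 1 * hent i j 0 0 + P' i j * Q' 0 0 * hent i j 1 1
      - P i j * Q 1 0 * hent i j 0 1 - P' i j * Q' 0 1 * hent i j 1 0
      - P i j ^ 2 * hQ + P' i j ^ 2 * hQ'
  · linear_combination Q i j * P 1 1 * hent 0 0 i j + Q' i j * P' 0 0 * hent 1 1 i j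
      - Q i j * P 1 0 * hent 0 1 i j - Q' i j * P' 0 1 * hent 1 0 i j
      - Q i j ^ 2 * hP + Q' i j ^ 2 * hP'

theorem thetaPlus_tensorMat [CharP F 2] {P Q : Matrix (Fin 2) (Fin 2) F}
    (hP : P.det = 1) (hQ : Q.det = 1) (x : Fin 2 ⊕ Fin 2 → F) :
    thetaPlus F 2 (tensorMat P Q *ᵥ x) = thetaPlus F 2 x := by
  have hdet : ∀ y : Fin 2 ⊕ Fin 2 → F, thetaPlus F 2 y =
      (of fun i j => y (blockIdx.symm (i, j))).det := fun y => by
    simp only [thetaPlus, Fin.sum_univ_two, det_fin_two, of_apply, CharTwo.sub_eq_add]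
    rfl
  have hmul : (of fun i j => (tensorMat P Q *ᵥ x) (blockIdx.symm (i, j))) =
      P * (of fun i j => x (blockIdx.symm (i, j))) * Qᵀ := by
    ext i j
    simp only [of_apply, mulVec, dotProduct, tensorMat_apply, mul_apply, transpose_apply]
    rw [← Equiv.sum_comp blockIdx.symm, Fintype.sum_prod_type]
    simp only [Fin.sum_univ_two, Equiv.apply_symm_apply]
    ring
  rw [hdet, hdet, hmul, det_mul, det_mul, det_transpose, hP, hQ, one_mul, mul_one]

/-- The coordinate swap `x₂ ↔ x₄`, an isometry outside `SO⁺`. -/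
def swapMat (F : Type) [Field F] : Matrix (Fin 2 ⊕ Fin 2) (Fin 2 ⊕ Fin 2) F :=
  (1 : Matrix (Fin 2 ⊕ Fin 2) (Fin 2 ⊕ Fin 2) F).submatrix id
    (Equiv.swap (Sum.inl 1) (Sum.inr 1))

theorem mul_swapMat_apply (w : Matrix (Fin 2 ⊕ Fin 2) (Fin 2 ⊕ Fin 2) F) (i j : Fin 2 ⊕ Fin 2) :
    (w * swapMat F) i j = w i (Equiv.swap (Sum.inl 1) (Sum.inr 1) j) := by
  simp [swapMat, mul_apply, one_apply]

theorem delta_tensorMat [CharP F 2] (P Q : Matrix (Fin 2) (Fin 2) F) :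
    trace (toBlocks₁₂ (tensorMat P Q) * (toBlocks₂₁ (tensorMat P Q))ᵀ) = 0 := by
  have h2 : (2 : F) = 0 := CharTwo.two_eq_zero
  simp only [trace, Matrix.diag, mul_apply, Fin.sum_univ_two, toBlocks₁₂, toBlocks₂₁, of_apply,
    transpose_apply, tensorMat_apply, blockIdx_inl_zero, blockIdx_inl_one, blockIdx_inr_zero,
    blockIdx_inr_one]
  linear_combination (P 0 1 * P 1 0 * (Q 0 0 * Q 1 1 + Q 0 1 * Q 1 0)) * h2

theorem delta_tensorMat_mul_swapMat [CharP F 2] {P Q : Matrix (Fin 2) (Fin 2) F}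
    (hP : P.det = 1) (hQ : Q.det = 1) :
    trace (toBlocks₁₂ (tensorMat P Q * swapMat F) *
      (toBlocks₂₁ (tensorMat P Q * swapMat F))ᵀ) = 1 := by
  have h2 : (2 : F) = 0 := CharTwo.two_eq_zero
  have s₀ : Equiv.swap (Sum.inl 1 : Fin 2 ⊕ Fin 2) (Sum.inr 1) (Sum.inl 0) = Sum.inl 0 := by decide
  have s₁ : Equiv.swap (Sum.inl 1 : Fin 2 ⊕ Fin 2) (Sum.inr 1) (Sum.inl 1) = Sum.inr 1 := by decide
  have s₂ : Equiv.swap (Sum.inl 1 : Fin 2 ⊕ Fin 2) (Sum.inr 1) (Sum.inr 0) = Sum.inr 0 := by decide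
  have s₃ : Equiv.swap (Sum.inl 1 : Fin 2 ⊕ Fin 2) (Sum.inr 1) (Sum.inr 1) = Sum.inl 1 := by decide
  rw [det_fin_two] at hP hQ
  simp only [toBlocks₁₂, toBlocks₂₁, mul_swapMat_apply]
  simp only [trace, Matrix.diag, mul_apply, Fin.sum_univ_two, of_apply,
    transpose_apply, s₀, s₁, s₂, s₃, tensorMat_apply, blockIdx_inl_zero,
    blockIdx_inl_one, blockIdx_inr_zero, blockIdx_inr_one]
  linear_combination (Q 0 0 * Q 1 1 - Q 0 1 * Q 1 0) * hP + hQ +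
    (P 0 1 * P 1 0 * (Q 0 0 * Q 1 1 + Q 0 1 * Q 1 0) +
      Q 0 1 * Q 1 0 * (P 0 0 * P 1 1 - P 0 1 * P 1 0)) * h2

theorem exists_det_eq_one_of_col {u v : F} (h : u ≠ 0 ∨ v ≠ 0) :
    ∃ P : Matrix (Fin 2) (Fin 2) F, P.det = 1 ∧ P 0 0 = u ∧ P 1 0 = v := by
  by_cases hu : u = 0
  · have hv : v ≠ 0 := h.resolve_left (not_not.2 hu)
    exact ⟨!![0, -v⁻¹; v, 0], by simp [det_fin_two, hv], by simp [hu], by simp⟩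
  · exact ⟨!![u, 0; v, u⁻¹], by simp [det_fin_two, hu], by simp, by simp⟩

theorem exists_tensorMat_col [CharP F 2] {x : Fin 2 ⊕ Fin 2 → F} (hx : x ≠ 0)
    (hθ : thetaPlus F 2 x = 0) :
    ∃ P Q : Matrix (Fin 2) (Fin 2) F, P.det = 1 ∧ Q.det = 1 ∧
      ∀ i, tensorMat P Q i (Sum.inl 0) = x i := by
  have h2 : (2 : F) = 0 := CharTwo.two_eq_zero
  have hx' : ¬ (x (Sum.inl 0) = 0 ∧ x (Sum.inl 1) = 0 ∧ x (Sum.inr 0) = 0 ∧ x (Sum.inr 1) = 0) := by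
    rintro ⟨h₀, h₁, h₂, h₃⟩
    refine hx (funext fun i => ?_)
    rcases i with i | i <;> fin_cases i <;> assumption
  simp only [thetaPlus, Fin.sum_univ_two] at hθ
  have key : ∃ u₀ u₁ v₀ v₁ : F, u₀ * v₀ = x (Sum.inl 0) ∧ u₀ * v₁ = x (Sum.inl 1) ∧
      u₁ * v₁ = x (Sum.inr 0) ∧ u₁ * v₀ = x (Sum.inr 1) := by
    by_cases ha : x (Sum.inl 0) = 0
    · by_cases hb : x (Sum.inl 1) = 0
      · exact ⟨0, 1, x (Sum.inr 1), x (Sum.inr 0), by simp [ha], by simp [hb], by simp, by simp⟩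
      · have hc : x (Sum.inr 1) = 0 := by simpa [ha, hb] using hθ
        exact ⟨1, x (Sum.inr 0) / x (Sum.inl 1), 0, x (Sum.inl 1), by simp [ha], by simp,
          by field_simp, by simp [hc]⟩
    · refine ⟨1, x (Sum.inr 1) / x (Sum.inl 0), x (Sum.inl 0), x (Sum.inl 1), by simp, by simp,
        ?_, by field_simp⟩
      field_simp
      linear_combination hθ - x (Sum.inl 0) * x (Sum.inr 0) * h2
  obtain ⟨u₀, u₁, v₀, v₁, h₀, h₁, h₂, h₃⟩ := key
  have hu : u₀ ≠ 0 ∨ u₁ ≠ 0 := by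
    by_contra! hc
    exact hx' (by simp [← h₀, ← h₁, ← h₂, ← h₃, hc.1, hc.2])
  have hv : v₀ ≠ 0 ∨ v₁ ≠ 0 := by
    by_contra! hc
    exact hx' (by simp [← h₀, ← h₁, ← h₂, ← h₃, hc.1, hc.2])
  obtain ⟨P, hP, hP₀, hP₁⟩ := exists_det_eq_one_of_col hu
  obtain ⟨Q, hQ, hQ₀, hQ₁⟩ := exists_det_eq_one_of_col hv
  refine ⟨P, Q, hP, hQ, fun i => ?_⟩
  rcases i with i | i <;> fin_cases i <;> simp [tensorMat_apply, *]

/-- The matrices in the image of `SL₂ × SL₂`, up to the swap. -/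
def IsTensorOrSwap (w : Matrix (Fin 2 ⊕ Fin 2) (Fin 2 ⊕ Fin 2) F) : Prop :=
  ∃ P Q : Matrix (Fin 2) (Fin 2) F, P.det = 1 ∧ Q.det = 1 ∧
    (w = tensorMat P Q ∨ w = tensorMat P Q * swapMat F)

theorem IsTensorOrSwap.of_adjugate_mul {w : Matrix (Fin 2 ⊕ Fin 2) (Fin 2 ⊕ Fin 2) F}
    {P Q : Matrix (Fin 2) (Fin 2) F} (hP : P.det = 1) (hQ : Q.det = 1)
    (h : IsTensorOrSwap (tensorMat P.adjugate Q.adjugate * w)) : IsTensorOrSwap w := by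
  obtain ⟨P', Q', hP', hQ', h⟩ := h
  have hw : tensorMat P Q * (tensorMat P.adjugate Q.adjugate * w) = w := by
    rw [← mul_assoc, tensorMat_mul, mul_adjugate, mul_adjugate, hP, hQ, one_smul, tensorMat_one,
      one_mul]
  refine ⟨P * P', Q * Q', by simp [hP, hP'], by simp [hQ, hQ'], ?_⟩
  rw [← hw, ← tensorMat_mul, mul_assoc]
  exact h.imp (congrArg _) (congrArg _)

theorem thetaPlus_col {w : Matrix (Fin 2 ⊕ Fin 2) (Fin 2 ⊕ Fin 2) F}
    (hw : ∀ x, thetaPlus F 2 (w *ᵥ x) = thetaPlus F 2 x) (j : Fin 2 ⊕ Fin 2) :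
    w (Sum.inl 0) j * w (Sum.inr 0) j + w (Sum.inl 1) j * w (Sum.inr 1) j = 0 := by
  have h := hw (Pi.single j 1)
  rcases j with j | j <;> fin_cases j <;> simpa [thetaPlus] using h

theorem thetaPlus_col_add {w : Matrix (Fin 2 ⊕ Fin 2) (Fin 2 ⊕ Fin 2) F}
    (hw : ∀ x, thetaPlus F 2 (w *ᵥ x) = thetaPlus F 2 x) (j k : Fin 2 ⊕ Fin 2) :
    (w (Sum.inl 0) j + w (Sum.inl 0) k) * (w (Sum.inr 0) j + w (Sum.inr 0) k) +
      (w (Sum.inl 1) j + w (Sum.inl 1) k) * (w (Sum.inr 1) j + w (Sum.inr 1) k) =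
      thetaPlus F 2 (Pi.single j 1 + Pi.single k 1) := by
  have h := hw (Pi.single j 1 + Pi.single k 1)
  rw [← h]
  simp [thetaPlus, mulVec_add]

theorem isTensorOrSwap_of_fix_inl_inr [Fintype F] [CharP F 2]
    {w : Matrix (Fin 2 ⊕ Fin 2) (Fin 2 ⊕ Fin 2) F}
    (hw : ∀ x, thetaPlus F 2 (w *ᵥ x) = thetaPlus F 2 x)
    (hl : ∀ i, w i (Sum.inl 0) = (1 : Matrix (Fin 2 ⊕ Fin 2) (Fin 2 ⊕ Fin 2) F) i (Sum.inl 0))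
    (hr : ∀ i, w i (Sum.inr 0) = (1 : Matrix (Fin 2 ⊕ Fin 2) (Fin 2 ⊕ Fin 2) F) i (Sum.inr 0)) :
    IsTensorOrSwap w := by
  have hg := thetaPlus_col hw (Sum.inl 1)
  have hh := thetaPlus_col hw (Sum.inr 1)
  have hlg := thetaPlus_col_add hw (Sum.inl 0) (Sum.inl 1)
  have hlh := thetaPlus_col_add hw (Sum.inl 0) (Sum.inr 1)
  have hrg := thetaPlus_col_add hw (Sum.inr 0) (Sum.inl 1)
  have hrh := thetaPlus_col_add hw (Sum.inr 0) (Sum.inr 1)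
  have hgh := thetaPlus_col_add hw (Sum.inl 1) (Sum.inr 1)
  simp [hl, hr, thetaPlus, one_apply, Pi.single_apply] at hlg hlh hrg hrh hgh
  have g₂ : w (Sum.inr 0) (Sum.inl 1) = 0 := by linear_combination hlg - hg
  have h₂ : w (Sum.inr 0) (Sum.inr 1) = 0 := by linear_combination hlh - hh
  have g₀ : w (Sum.inl 0) (Sum.inl 1) = 0 := by linear_combination hrg - hg
  have h₀ : w (Sum.inl 0) (Sum.inr 1) = 0 := by linear_combination hrh - hh
  simp only [g₀, g₂, h₀, h₂, add_zero, zero_add, mul_zero] at hg hh hgh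
  have hsq : ∀ c : F, c ≠ 0 → ∃ β : F, β ≠ 0 ∧ β ^ 2 = c := fun c hc => by
    obtain ⟨β, hβ⟩ := (bijective_sq (F := F)).surjective c
    exact ⟨β, by rintro rfl; exact hc (by simpa using hβ.symm), hβ⟩
  have hcross : w (Sum.inl 1) (Sum.inl 1) * w (Sum.inr 1) (Sum.inr 1) +
      w (Sum.inr 1) (Sum.inl 1) * w (Sum.inl 1) (Sum.inr 1) = 1 := by
    linear_combination hgh - hg - hh
  rcases mul_eq_zero.1 hg with g₁ | g₃
  · rw [g₁, zero_mul, zero_add] at hcross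
    have h₁ : w (Sum.inl 1) (Sum.inr 1) ≠ 0 := right_ne_zero_of_mul_eq_one hcross
    have h₃ : w (Sum.inr 1) (Sum.inr 1) = 0 := by simpa [h₁] using hh
    have g₃ : w (Sum.inr 1) (Sum.inl 1) = (w (Sum.inl 1) (Sum.inr 1))⁻¹ :=
      eq_inv_of_mul_eq_one_left hcross
    obtain ⟨β, hβ, hβ2⟩ := hsq _ h₁
    refine ⟨!![β, 0; 0, β⁻¹], !![β⁻¹, 0; 0, β], by simp [det_fin_two, hβ],
      by simp [det_fin_two, hβ], Or.inr ?_⟩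
    ext i j
    rw [mul_swapMat_apply]
    rcases i with i | i <;> fin_cases i <;> rcases j with j | j <;> fin_cases j <;>
      simp [hl, hr, g₀, g₁, g₂, g₃, h₀, h₂, h₃, ← hβ2, hβ, tensorMat_apply, one_apply,
        Equiv.swap_apply_def, sq]
  · rw [g₃, zero_mul, add_zero] at hcross
    have g₁ : w (Sum.inl 1) (Sum.inl 1) ≠ 0 := left_ne_zero_of_mul_eq_one hcross
    have h₃ : w (Sum.inr 1) (Sum.inr 1) = (w (Sum.inl 1) (Sum.inl 1))⁻¹ :=
      eq_inv_of_mul_eq_one_right hcross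
    have h₁ : w (Sum.inl 1) (Sum.inr 1) = 0 := by simpa [h₃, g₁] using hh
    obtain ⟨β, hβ, hβ2⟩ := hsq _ g₁
    refine ⟨!![β, 0; 0, β⁻¹], !![β⁻¹, 0; 0, β], by simp [det_fin_two, hβ],
      by simp [det_fin_two, hβ], Or.inl ?_⟩
    ext i j
    rcases i with i | i <;> fin_cases i <;> rcases j with j | j <;> fin_cases j <;>
      simp [hl, hr, g₀, g₂, g₃, h₀, h₁, h₂, h₃, ← hβ2, hβ, tensorMat_apply, one_apply, sq]

theorem isTensorOrSwap_of_fix_inl [Fintype F] [CharP F 2]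
    {w : Matrix (Fin 2 ⊕ Fin 2) (Fin 2 ⊕ Fin 2) F}
    (hw : ∀ x, thetaPlus F 2 (w *ᵥ x) = thetaPlus F 2 x)
    (hl : ∀ i, w i (Sum.inl 0) = (1 : Matrix (Fin 2 ⊕ Fin 2) (Fin 2 ⊕ Fin 2) F) i (Sum.inl 0)) :
    IsTensorOrSwap w := by
  have hf := thetaPlus_col hw (Sum.inr 0)
  have hlf := thetaPlus_col_add hw (Sum.inl 0) (Sum.inr 0)
  simp [hl, thetaPlus, one_apply, Pi.single_apply] at hlf
  have f₂ : w (Sum.inr 0) (Sum.inr 0) = 1 := by linear_combination hlf - hf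
  have f₀ : w (Sum.inl 0) (Sum.inr 0) = w (Sum.inl 1) (Sum.inr 0) * w (Sum.inr 1) (Sum.inr 0) := by
    rw [f₂, mul_one] at hf
    exact CharTwo.add_eq_zero.1 hf
  have hP : (!![1, w (Sum.inl 1) (Sum.inr 0); 0, 1] : Matrix (Fin 2) (Fin 2) F).det = 1 := by
    simp [det_fin_two]
  have hQ : (!![1, w (Sum.inr 1) (Sum.inr 0); 0, 1] : Matrix (Fin 2) (Fin 2) F).det = 1 := by
    simp [det_fin_two]
  refine .of_adjugate_mul hP hQ (isTensorOrSwap_of_fix_inl_inr (fun x => ?_) (fun i => ?_)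
    fun i => ?_)
  · rw [← mulVec_mulVec, thetaPlus_tensorMat (det_adjugate_of_det_eq_one hP)
      (det_adjugate_of_det_eq_one hQ), hw]
  · rw [← tensorMat_adjugate_mul hP hQ, mul_apply, mul_apply]
    refine Finset.sum_congr rfl fun k _ => congrArg _ ?_
    rw [hl]
    rcases k with k | k <;> fin_cases k <;> simp [tensorMat_apply, one_apply]
  · rw [← tensorMat_adjugate_mul hP hQ, mul_apply, mul_apply]
    refine Finset.sum_congr rfl fun k _ => congrArg _ ?_
    rcases k with k | k <;> fin_cases k <;> simp [tensorMat_apply, f₀, f₂]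

theorem isTensorOrSwap_of_isometry [Fintype F] [CharP F 2]
    {w : Matrix (Fin 2 ⊕ Fin 2) (Fin 2 ⊕ Fin 2) F} (hunit : IsUnit w)
    (hw : ∀ x, thetaPlus F 2 (w *ᵥ x) = thetaPlus F 2 x) : IsTensorOrSwap w := by
  have hne : (fun i => w i (Sum.inl 0)) ≠ 0 := fun h => by
    have : w *ᵥ Pi.single (Sum.inl 0) 1 = w *ᵥ 0 := by
      rw [mulVec_single_one, mulVec_zero]
      exact h
    simpa using congrFun (mulVec_injective_of_isUnit hunit this) (Sum.inl 0)
  obtain ⟨P, Q, hP, hQ, hcol⟩ := exists_tensorMat_col hne (by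
    simpa [thetaPlus, Fin.sum_univ_two] using thetaPlus_col hw (Sum.inl 0))
  refine .of_adjugate_mul hP hQ (isTensorOrSwap_of_fix_inl (fun x => ?_) fun i => ?_)
  · rw [← mulVec_mulVec, thetaPlus_tensorMat (det_adjugate_of_det_eq_one hP)
      (det_adjugate_of_det_eq_one hQ), hw]
  · rw [← tensorMat_adjugate_mul hP hQ, mul_apply, mul_apply]
    exact Finset.sum_congr rfl fun k _ => congrArg _ (hcol k).symm

theorem mem_SOplusGrp_two_iff [Fintype F] [DecidableEq F] [CharP F 2]
    (w : Matrix (Fin 2 ⊕ Fin 2) (Fin 2 ⊕ Fin 2) F) :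
    w ∈ SOplusGrp F 2 ↔ ∃ P Q : Matrix (Fin 2) (Fin 2) F, P.det = 1 ∧ Q.det = 1 ∧
      tensorMat P Q = w := by
  simp only [SOplusGrp, OplusGrp, Finset.mem_filter, Finset.mem_univ, true_and]
  constructor
  · rintro ⟨⟨hunit, hw⟩, hδ⟩
    obtain ⟨P, Q, hP, hQ, rfl | rfl⟩ := isTensorOrSwap_of_isometry hunit hw
    · exact ⟨P, Q, hP, hQ, rfl⟩
    · rw [delta_tensorMat_mul_swapMat hP hQ] at hδ
      exact absurd hδ one_ne_zero
  · rintro ⟨P, Q, hP, hQ, rfl⟩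
    exact ⟨⟨IsUnit.of_mul_eq_one_right _ (tensorMat_adjugate_mul hP hQ),
      thetaPlus_tensorMat hP hQ⟩, delta_tensorMat P Q⟩

theorem sum_SOplusGrp_two [Fintype F] [DecidableEq F] [CharP F 2] (φ : F → ℤ) :
    ∑ w ∈ SOplusGrp F 2, φ w.trace =
      ∑ P ∈ univ.filter (fun P : Matrix (Fin 2) (Fin 2) F => P.det = 1),
        ∑ Q ∈ univ.filter (fun Q : Matrix (Fin 2) (Fin 2) F => Q.det = 1),
          φ (P.trace * Q.trace) := by
  rw [← Finset.sum_product']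
  symm
  refine Finset.sum_nbij (fun p => tensorMat p.1 p.2) ?_ ?_ ?_ ?_
  · intro p hp
    simp only [Finset.mem_product, Finset.mem_filter, Finset.mem_univ, true_and] at hp
    exact (mem_SOplusGrp_two_iff _).2 ⟨_, _, hp.1, hp.2, rfl⟩
  · intro p hp p' hp' h
    simp only [Finset.coe_product, Finset.coe_filter, Finset.mem_univ, true_and, Set.mem_prod,
      Set.mem_ofPred_eq] at hp hp'
    exact Prod.ext_iff.2 (tensorMat_injOn hp.1 hp'.1 hp.2 hp'.2 h)
  · intro w hw
    obtain ⟨P, Q, hP, hQ, rfl⟩ := (mem_SOplusGrp_two_iff _).1 hw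
    exact ⟨(P, Q), by simp [hP, hQ], rfl⟩
  · intro p _
    rw [trace_tensorMat]

end OrthogonalGroup

theorem two_mul_card_filter_lam {F : Type} [Field F] {r : ℕ}
    (G : Finset (Matrix (Fin 2 ⊕ Fin 2) (Fin 2 ⊕ Fin 2) F)) (a : F) :
    2 * ((univ.filter fun g : ↥G =>
        lam F r (a * Matrix.trace (g : Matrix (Fin 2 ⊕ Fin 2) (Fin 2 ⊕ Fin 2) F)) = -1).card : ℤ) =
      G.card - ∑ w ∈ G, lam F r (a * w.trace) := by
  have h1 : ∀ w : Matrix (Fin 2 ⊕ Fin 2) (Fin 2 ⊕ Fin 2) F,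
      2 * (if lam F r (a * w.trace) = -1 then 1 else 0 : ℤ) = 1 - lam F r (a * w.trace) := fun w => by
    rcases lam_eq_one_or_neg_one (r := r) (a * w.trace) with h | h <;> rw [h] <;> norm_num
  rw [Finset.card_filter, Nat.cast_sum, Finset.mul_sum, ← Finset.sum_coe_sort G,
    ← Fintype.card_coe G, ← Finset.card_univ, Finset.card_eq_sum_ones, Nat.cast_sum,
    ← Finset.sum_sub_distrib]
  refine Finset.sum_congr rfl fun g _ => ?_
  rw [Nat.cast_one, ← h1]
  push_cast
  rfl

section GaussSum

variable {F : Type} [Field F] [Fintype F] [DecidableEq F] {r : ℕ}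

theorem card_mul_eq (k : F) :
    ((univ.filter fun p : F × F => p.1 * p.2 = k).card : ℤ) =
      Fintype.card F - 1 + if k = 0 then (Fintype.card F : ℤ) else 0 := by
  have hb : ∀ b : F, ((univ.filter fun c : F => b * c = k).card : ℤ) =
      1 + if b = 0 then ((if k = 0 then (Fintype.card F : ℤ) else 0) - 1) else 0 := by
    intro b
    split_ifs with hb hk
    · simp [hb, hk]
    · simp [hb, Ne.symm hk]
    · rw [show (univ.filter fun c : F => b * c = k) = {b⁻¹ * k} by
        ext c
        simp [eq_inv_mul_iff_mul_eq₀ hb]]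
      simp
  have hsum : (univ.filter fun p : F × F => p.1 * p.2 = k).card =
      ∑ b : F, (univ.filter fun c : F => b * c = k).card := by
    simp only [Finset.card_filter, Fintype.sum_prod_type]
  rw [hsum, Nat.cast_sum, Finset.sum_congr rfl fun b _ => hb b, Finset.sum_add_distrib]
  simp
  ring

theorem card_roots_reciprocal [CharP F 2] (hr : 1 ≤ r) (hF : Fintype.card F = 2 ^ r) (t : F) :
    ((univ.filter fun a : F => a * (t - a) - 1 = 0).card : ℤ) =
      1 + if t = 0 then 0 else lam F r t⁻¹ := by
  have h2 : (2 : F) = 0 := CharTwo.two_eq_zero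
  split_ifs with ht
  · rw [show (univ.filter fun a : F => a * (t - a) - 1 = 0) = {1} by
      ext a
      simp only [ht, Finset.mem_filter, Finset.mem_univ, true_and, Finset.mem_singleton]
      rw [← CharTwo.sq_inj (x := a), one_pow]
      constructor <;> intro h
      · linear_combination -h - h2
      · linear_combination -h - h2]
    simp
  · rw [← lam_sq hF, ← card_sq_add_self_eq hr hF]
    congr 1
    refine Finset.card_nbij' (fun a => a * t⁻¹) (fun y => y * t) ?_ ?_ ?_ ?_
    · intro a ha
      simp only [Finset.coe_filter, Finset.mem_univ, true_and, Set.mem_ofPred_eq] at ha ⊢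
      field_simp
      linear_combination -ha + (a * t - 1) * h2
    · intro y hy
      simp only [Finset.coe_filter, Finset.mem_univ, true_and, Set.mem_ofPred_eq] at hy ⊢
      field_simp at hy
      linear_combination -hy + (y * t ^ 2 - 1) * h2
    · intro a _
      field_simp
    · intro y _
      field_simp

theorem card_det_eq_one_trace_eq [CharP F 2] (hr : 1 ≤ r) (hF : Fintype.card F = 2 ^ r) (t : F) :
    ((univ.filter fun P : Matrix (Fin 2) (Fin 2) F => P.det = 1 ∧ P.trace = t).card : ℤ) =
      (2 ^ r) ^ 2 + 2 ^ r * if t = 0 then 0 else lam F r t⁻¹ := by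
  have hcard : (univ.filter fun P : Matrix (Fin 2) (Fin 2) F => P.det = 1 ∧ P.trace = t).card =
      (univ.filter fun x : F × F × F => x.2.1 * x.2.2 = x.1 * (t - x.1) - 1).card := by
    refine Finset.card_nbij' (fun P => (P 0 0, P 0 1, P 1 0))
      (fun x => !![x.1, x.2.1; x.2.2, t - x.1]) ?_ ?_ ?_ ?_
    · intro P hP
      simp only [Finset.coe_filter, Finset.mem_univ, true_and, Set.mem_ofPred_eq, det_fin_two,
        trace_fin_two] at hP ⊢
      linear_combination P 0 0 * hP.2 - hP.1
    · intro x hx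
      simp only [Finset.coe_filter, Finset.mem_univ, true_and, Set.mem_ofPred_eq] at hx ⊢
      simp [det_fin_two, trace_fin_two, hx]
    · intro P hP
      simp only [Finset.coe_filter, Finset.mem_univ, true_and, Set.mem_ofPred_eq,
        trace_fin_two] at hP
      ext i j
      fin_cases i <;> fin_cases j <;> simp [← hP.2]
    · intro x _
      simp
  have hsum : (univ.filter fun x : F × F × F => x.2.1 * x.2.2 = x.1 * (t - x.1) - 1).card =
      ∑ a : F, (univ.filter fun p : F × F => p.1 * p.2 = a * (t - a) - 1).card := by
    simp only [Finset.card_filter, Fintype.sum_prod_type]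
  have hroots := card_roots_reciprocal hr hF t
  rw [hcard, hsum, Nat.cast_sum, Finset.sum_congr rfl fun a _ => card_mul_eq _,
    Finset.sum_add_distrib, ← Finset.sum_filter, Finset.sum_const, Finset.sum_const, nsmul_eq_mul,
    nsmul_eq_mul, hroots, Finset.card_univ, hF]
  push_cast
  ring

theorem sum_det_eq_one_trace [CharP F 2] (hr : 1 ≤ r) (hF : Fintype.card F = 2 ^ r)
    (ψ : F → ℤ) :
    ∑ P ∈ univ.filter (fun P : Matrix (Fin 2) (Fin 2) F => P.det = 1), ψ P.trace =
      (2 ^ r) ^ 2 * ∑ t, ψ t +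
        2 ^ r * ∑ t ∈ univ.filter (fun t : F => t ≠ 0), lam F r t * ψ t⁻¹ := by
  rw [← Finset.sum_fiberwise' _ (fun P : Matrix (Fin 2) (Fin 2) F => P.trace) ψ]
  simp only [Finset.sum_const, nsmul_eq_mul, Finset.filter_filter,
    card_det_eq_one_trace_eq hr hF, add_mul, Finset.sum_add_distrib, mul_assoc,
    ← Finset.mul_sum]
  congr 2
  rw [Finset.sum_filter, ← inv_involutive.bijective.sum_comp]
  refine Finset.sum_congr rfl fun t _ => ?_
  by_cases ht : t = 0 <;> simp [ht]

theorem sum_lam_ne_zero [CharP F 2] (hr : 1 ≤ r) (hF : Fintype.card F = 2 ^ r) :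
    ∑ t ∈ univ.filter (fun t : F => t ≠ 0), lam F r t = -1 := by
  have h := Finset.sum_filter_add_sum_filter_not univ (fun t : F => t = 0) (lam F r)
  rw [sum_lam hr hF, Finset.filter_eq' univ (0 : F), if_pos (Finset.mem_univ _),
    Finset.sum_singleton, lam_zero] at h
  linarith

theorem card_SOplusGrp_two [CharP F 2] (hr : 1 ≤ r) (hF : Fintype.card F = 2 ^ r) :
    ((SOplusGrp F 2).card : ℤ) = (2 ^ r) ^ 2 * ((2 ^ r) ^ 2 - 1) ^ 2 := by
  have h := sum_SOplusGrp_two (F := F) fun _ => 1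
  have h₁ := sum_det_eq_one_trace (F := F) hr hF fun _ => 1
  simp only [mul_one, sum_lam_ne_zero hr hF, Finset.sum_const, nsmul_eq_mul, Finset.card_univ,
    hF] at h h₁
  rw [h, h₁]
  push_cast
  ring

theorem Klm_two_eq (a : F) :
    Klm F r 2 a = ∑ x ∈ univ.filter (fun x : F => x ≠ 0), ∑ y ∈ univ.filter (fun y : F => y ≠ 0),
      lam F r (x + y + a * (x * y)⁻¹) := by
  rw [← Finset.sum_product', Klm]
  refine Finset.sum_nbij' (fun v => (v 0, v 1)) (fun p => ![p.1, p.2]) ?_ ?_ ?_ ?_ ?_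
  · intro v hv
    simpa [Fin.forall_fin_two] using hv
  · intro p hp
    simpa [Fin.forall_fin_two] using hp
  · intro v _
    ext i
    fin_cases i <;> rfl
  · intro p _
    rfl
  · intro v _
    simp [Fin.sum_univ_two, Fin.prod_univ_two]

/-- The Gauss sum of `SO⁺(4,q)` in terms of the two-dimensional Kloosterman sum. -/
theorem gaussSum_SOplusGrp_two [CharP F 2] (hr : 1 ≤ r) (hF : Fintype.card F = 2 ^ r)
    {a : F} (ha : a ≠ 0) :
    ∑ w ∈ SOplusGrp F 2, lam F r (a * w.trace) = (2 ^ r) ^ 5 + (2 ^ r) ^ 2 * Klm F r 2 a := by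
  rw [sum_SOplusGrp_two fun x => lam F r (a * x)]
  simp only [fun t : F => sum_det_eq_one_trace hr hF fun s => lam F r (a * (t * s))]
  rw [sum_det_eq_one_trace hr hF fun t => (2 ^ r) ^ 2 * ∑ s, lam F r (a * (t * s)) +
    2 ^ r * ∑ s ∈ univ.filter (fun s : F => s ≠ 0), lam F r s * lam F r (a * (t * s⁻¹))]
  have h₁ : ∀ t : F, ∑ s, lam F r (a * (t * s)) = if t = 0 then 2 ^ r else 0 := fun t => by
    simp only [← mul_assoc, sum_lam_mul hr hF, mul_eq_zero, ha, false_or]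
  have h₂ : ∑ t : F, ∑ s ∈ univ.filter (fun s : F => s ≠ 0),
      lam F r s * lam F r (a * (t * s⁻¹)) = 0 := by
    rw [Finset.sum_comm]
    refine Finset.sum_eq_zero fun s hs => ?_
    have hs0 : a * s⁻¹ ≠ 0 := mul_ne_zero ha (inv_ne_zero (by simpa using hs))
    simp only [mul_left_comm a, mul_comm _ (a * s⁻¹), ← Finset.mul_sum, sum_lam_mul hr hF,
      if_neg hs0, mul_zero]
  have h₃ : ∀ t ∈ univ.filter (fun t : F => t ≠ 0), lam F r t *
      ((2 ^ r) ^ 2 * ∑ s, lam F r (a * (t⁻¹ * s)) +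
        2 ^ r * ∑ s ∈ univ.filter (fun s : F => s ≠ 0),
          lam F r s * lam F r (a * (t⁻¹ * s⁻¹))) =
      2 ^ r * ∑ s ∈ univ.filter (fun s : F => s ≠ 0), lam F r (t + s + a * (t * s)⁻¹) := by
    intro t ht
    rw [h₁, if_neg (inv_ne_zero (by simpa using ht)), mul_zero, zero_add, mul_left_comm,
      Finset.mul_sum]
    refine congrArg _ (Finset.sum_congr rfl fun s _ => ?_)
    rw [lam_add hF, lam_add hF, mul_inv, mul_assoc]
  rw [Finset.sum_congr rfl h₃, ← Finset.mul_sum, ← Klm_two_eq, Finset.sum_add_distrib,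
    ← Finset.mul_sum, ← Finset.mul_sum, h₂]
  simp only [h₁, Finset.sum_ite_eq', Finset.mem_univ, if_true]
  ring

/-- The power moments of the weights of the dual of `C(SO⁺(4,q))`. -/
theorem sum_sub_Klm_pow [CharP F 2] (hr : 1 ≤ r) (hF : Fintype.card F = 2 ^ r) {h : ℕ}
    (hh : h ≠ 0) :
    ∑ a : F, (2 : ℤ) ^ h * ((univ.filter fun g : ↥(SOplusGrp F 2) =>
        lam F r (a * Matrix.trace (g : Matrix (Fin 2 ⊕ Fin 2) (Fin 2 ⊕ Fin 2) F)) = -1).card : ℤ) ^ h =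
      ((2 ^ r) ^ 2) ^ h * ∑ a ∈ univ.filter (fun a : F => a ≠ 0),
        ((2 ^ r) ^ 4 - (2 ^ r) ^ 3 - 2 * (2 ^ r) ^ 2 + 1 - Klm F r 2 a) ^ h := by
  rw [Finset.mul_sum, Finset.sum_filter]
  refine Finset.sum_congr rfl fun a _ => ?_
  rw [← mul_pow, two_mul_card_filter_lam]
  split_ifs with ha
  · rw [gaussSum_SOplusGrp_two hr hF ha, card_SOplusGrp_two hr hF]
    refine Eq.trans (congrArg (· ^ h) ?_) (mul_pow _ _ h)
    ring
  · rw [not_not.1 ha]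
    simp [lam_zero, hh]

end GaussSum

theorem stmt2 (r : ℕ) (hr : 2 ≤ r) (F : Type) [Field F] [Fintype F] [DecidableEq F]
    (hF : Fintype.card F = 2 ^ r) (N₃ : ℕ)
    (hN₃ : N₃ = 2 ^ (2 * r) * (2 ^ (2 * r) - 1) ^ 2)
    (h : ℕ) (hh : 1 ≤ h) :
    (SOplusGrp F 2).card = N₃ ∧
    (MK2 F r h : ℚ) =
      (∑ l ∈ Finset.range h,
        (-1 : ℚ) ^ (h + l + 1) * (h.choose l : ℚ) *
          ((2 ^ r : ℚ) ^ 4 - (2 ^ r : ℚ) ^ 3 - 2 * (2 ^ r : ℚ) ^ 2 + 1) ^ (h - l) *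
          (MK2 F r l : ℚ)) +
      (2 ^ r : ℚ) ^ (1 - 2 * (h : ℤ)) *
        ∑ j ∈ Finset.range (min N₃ h + 1),
          (-1 : ℚ) ^ (h + j) * (wtCount F (SOplusGrp F 2) j : ℚ) *
            ∑ t ∈ Finset.Icc j h,
              (tS h t : ℚ) * 2 ^ (h - t) *
                (ichoose ((N₃ : ℤ) - (j : ℤ)) ((N₃ : ℤ) - (t : ℤ)) : ℚ) := by
  have hr1 : 1 ≤ r := by omega
  have : CharP F 2 := charP_of_card_eq_prime_pow hF
  have hcard : (SOplusGrp F 2).card = N₃ := by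
    have h1 : 1 ≤ 2 ^ (2 * r) := Nat.one_le_two_pow
    zify [h1] at hN₃
    zify
    rw [card_SOplusGrp_two hr1 hF, hN₃]
    ring
  refine ⟨hcard, ?_⟩
  have key := (sum_sub_Klm_pow hr1 hF (by omega : h ≠ 0)).symm.trans
    (sum_card_filter_lam_pow hr1 hF (SOplusGrp F 2) h)
  rw [hcard] at key
  have hq : (2 ^ r : ℚ) ≠ 0 := by positivity
  set m : ℤ := (2 ^ r) ^ 4 - (2 ^ r) ^ 3 - 2 * (2 ^ r) ^ 2 + 1 with hm
  have hmQ : ((2 ^ r : ℚ) ^ 4 - (2 ^ r : ℚ) ^ 3 - 2 * (2 ^ r : ℚ) ^ 2 + 1) = (m : ℚ) := by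
    rw [hm]
    push_cast
    ring
  have hexpand : ∑ a ∈ univ.filter (fun a : F => a ≠ 0), (m - Klm F r 2 a) ^ h =
      (∑ l ∈ Finset.range h, (-1) ^ l * (h.choose l : ℤ) * m ^ (h - l) * MK2 F r l) +
        (-1) ^ h * MK2 F r h := by
    have hl : ∀ a : F, (m - Klm F r 2 a) ^ h = ∑ l ∈ Finset.range (h + 1),
        (-1) ^ l * (h.choose l : ℤ) * m ^ (h - l) * Klm F r 2 a ^ l := fun a => by
      rw [sub_eq_neg_add, add_pow]
      refine Finset.sum_congr rfl fun l _ => ?_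
      rw [neg_pow]
      ring
    simp only [hl]
    rw [Finset.sum_comm, Finset.sum_range_succ]
    simp [← Finset.mul_sum, MK2]
  have hsign : ((-1 : ℚ) ^ h) * (-1) ^ h = 1 := by
    rw [← mul_pow]
    simp
  have hkeyQ := congrArg (fun z : ℤ => (z : ℚ)) key
  simp only [hexpand] at hkeyQ
  push_cast at hkeyQ
  have hpow : (2 ^ r : ℚ) ^ (1 - 2 * (h : ℤ)) * ((2 ^ r) ^ 2) ^ h = 2 ^ r := by
    rw [← pow_mul, ← zpow_natCast (2 ^ r : ℚ) (2 * h), ← zpow_add₀ hq]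
    simp
  have hpow' : ((2 ^ r : ℚ) ^ 2) ^ h ≠ 0 := by positivity
  have hterms : (2 ^ r : ℚ) ^ (1 - 2 * (h : ℤ)) *
      ∑ j ∈ Finset.range (min N₃ h + 1), (-1 : ℚ) ^ j * (wtCount F (SOplusGrp F 2) j : ℚ) *
        ∑ t ∈ Finset.Icc j h, (tS h t : ℚ) * 2 ^ (h - t) *
          (ichoose ((N₃ : ℤ) - (j : ℤ)) ((N₃ : ℤ) - (t : ℤ)) : ℚ) =
      (∑ l ∈ Finset.range h, (-1) ^ l * (h.choose l : ℚ) * (m : ℚ) ^ (h - l) * (MK2 F r l : ℚ)) +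
        (-1) ^ h * (MK2 F r h : ℚ) := by
    refine mul_left_cancel₀ hpow' (Eq.trans ?_ hkeyQ.symm)
    rw [← mul_assoc, mul_comm _ ((2 ^ r : ℚ) ^ (1 - 2 * (h : ℤ))), hpow]
  have hrec : (∑ l ∈ Finset.range h, (-1 : ℚ) ^ (h + l + 1) * (h.choose l : ℚ) *
      (m : ℚ) ^ (h - l) * (MK2 F r l : ℚ)) = -(-1) ^ h *
      ∑ l ∈ Finset.range h, (-1) ^ l * (h.choose l : ℚ) * (m : ℚ) ^ (h - l) * (MK2 F r l : ℚ) := by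
    rw [Finset.mul_sum]
    exact Finset.sum_congr rfl fun l _ => by ring
  rw [hmQ, hrec]
  simp only [pow_add (-1 : ℚ) h, mul_assoc ((-1 : ℚ) ^ h), ← Finset.mul_sum]
  rw [mul_left_comm, hterms]
  linear_combination -(MK2 F r h : ℚ) * hsign
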